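/- Fix a positive integer N. There exist a constant C' > 0 and a threshold L (both depending only on Σ and N) such that for every set S of at most N finite nonempty admissible words, none containing another as a subword, in which every word has length at least ℓ ≥ L, one has h(Σ) − h(Σ⟨S⟩) ≤ C'·ℓ^{−3/4}·λ^{−ℓ/8}. -/

import Mathlib

open Filter MeasureTheory
open scoped BigOperators

namespace SFT

/-- A finite word `x_1 ⋯ x_m` is admissible if the `(x_{j+1}, x_j)` entry of `T`
equals `1` for all `1 ≤ j < m`. -/
def Admissible {n : ℕ} (T : Matrix (Fin n) (Fin n) ℝ) (w : List (Fin n)) : Prop :=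
  w.Chain' fun a b => T b a = 1

/-- The subshift of finite type `Σ` determined by `T`: bi-infinite sequences with
all transitions allowed. -/
def SFTspace {n : ℕ} (T : Matrix (Fin n) (Fin n) ℝ) : Set (ℤ → Fin n) :=
  {x | ∀ i : ℤ, T (x (i + 1)) (x i) = 1}

/-- The word `w` occurs in the bi-infinite sequence `x` starting at coordinate `a`. -/
def OccursAt {A : Type*} (w : List A) (x : ℤ → A) (a : ℤ) : Prop :=
  ∀ (j : ℕ) (h : j < w.length), x (a + j) = w.get ⟨j, h⟩

/-- The word `w` occurs somewhere in the bi-infinite sequence `x`. -/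
def Occurs {A : Type*} (w : List A) (x : ℤ → A) : Prop :=
  ∃ a : ℤ, OccursAt w x a

/-- `N_X(m)`: the number of words of length `m` occurring in elements of `X`. -/
noncomputable def wordCount {A : Type*} (X : Set (ℤ → A)) (m : ℕ) : ℕ :=
  {w : List A | w.length = m ∧ ∃ x ∈ X, Occurs w x}.ncard

/-- The entropy `h(X) = lim_{m→∞} (1/m) log N_X(m)` of a subshift (for subshifts the
limit exists, hence coincides with the limsup used here). -/
noncomputable def entropy {A : Type*} (X : Set (ℤ → A)) : ℝ :=
  Filter.atTop.limsup fun m : ℕ => Real.log (wordCount X m) / m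

/-- `Σ⟨S⟩`: the elements of `Σ` in which no word of `S` occurs. -/
def Avoid {n : ℕ} (T : Matrix (Fin n) (Fin n) ℝ) (S : Finset (List (Fin n))) :
    Set (ℤ → Fin n) :=
  {x ∈ SFTspace T | ∀ τ ∈ S, ¬ Occurs τ x}

/-- `p(t) = ∑_{τ ∈ S} t^{|τ|}`. -/
noncomputable def wordPoly {n : ℕ} (S : Finset (List (Fin n))) (t : ℝ) : ℝ :=
  ∑ τ ∈ S, t ^ τ.length

/-- The cylinder set `[σ]` (inside `Σ`), with `σ` beginning at coordinate `0`.
It is empty when `σ` is not admissible. -/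
def cylinder {n : ℕ} (T : Matrix (Fin n) (Fin n) ℝ) (σ : List (Fin n)) :
    Set (ℤ → Fin n) :=
  {x ∈ SFTspace T | OccursAt σ x 0}

/-- `N(σ, k)`: the number of words `η` of length `k` such that `ση` is admissible. -/
noncomputable def extCount {n : ℕ} (T : Matrix (Fin n) (Fin n) ℝ) (σ : List (Fin n))
    (k : ℕ) : ℕ :=
  {η : List (Fin n) | η.length = k ∧ Admissible T (σ ++ η)}.ncard

/-- A word is `S`-free if no element of `S` occurs in it as a consecutive subword. -/
def SFree {A : Type*} (S : Finset (List A)) (w : List A) : Prop :=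
  ∀ τ ∈ S, ¬ τ <:+: w

open Classical in
/-- `f_σ(α) = ∑_{τ ∈ S} ∑_j t^j`, the inner sum over integers `j ≥ 0` such that `τ`
occurs in `α` beginning within `σ` (placed at coordinate `0`) and ending `j` symbols
beyond the end of `σ`. -/
noncomputable def fword {n : ℕ} (S : Finset (List (Fin n))) (t : ℝ) (σ : List (Fin n))
    (x : ℤ → Fin n) : ℝ :=
  ∑ τ ∈ S, ∑ j ∈ Finset.range τ.length,
    if τ.length ≤ σ.length + j ∧ OccursAt τ x ((σ.length : ℤ) + j - τ.length)
    then t ^ j else 0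

/-- The weight `w(σ) = (1/μ([σ])) ∫_{[σ]} f_σ dμ`. -/
noncomputable def weight {n : ℕ} (T : Matrix (Fin n) (Fin n) ℝ)
    (μ : Measure (ℤ → Fin n)) (S : Finset (List (Fin n))) (t : ℝ)
    (σ : List (Fin n)) : ℝ :=
  (∫ x in cylinder T σ, fword S t σ x ∂μ) / (μ (cylinder T σ)).toReal

/-- `p_σ = ∑_{τ ∈ S} (μ([στ])/μ([σ])) t^{|τ|}`. -/
noncomputable def pWord {n : ℕ} (T : Matrix (Fin n) (Fin n) ℝ)
    (μ : Measure (ℤ → Fin n)) (S : Finset (List (Fin n))) (t : ℝ)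
    (σ : List (Fin n)) : ℝ :=
  ∑ τ ∈ S, (μ (cylinder T (σ ++ τ))).toReal / (μ (cylinder T σ)).toReal * t ^ τ.length

/-- `S_{σ,j}`: the subset of `[σ]` of elements containing some `τ ∈ S` that begins
within `σ` and ends `j` symbols after the end of `σ`. -/
def Ssub {n : ℕ} (T : Matrix (Fin n) (Fin n) ℝ) (S : Finset (List (Fin n)))
    (σ : List (Fin n)) (j : ℕ) : Set (ℤ → Fin n) :=
  {x ∈ cylinder T σ | ∃ τ ∈ S, τ.length ≤ σ.length + j ∧ j < τ.length ∧
    OccursAt τ x ((σ.length : ℤ) + j - τ.length)}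

/-- `η` is a good extension of an `S`-free word `σ`: `ση` is admissible and every
intermediate word between `σ` and `ση` (inclusive) has weight `< 1`. -/
def GoodExt {n : ℕ} (T : Matrix (Fin n) (Fin n) ℝ) (μ : Measure (ℤ → Fin n))
    (S : Finset (List (Fin n))) (t : ℝ) (σ η : List (Fin n)) : Prop :=
  Admissible T (σ ++ η) ∧ ∀ η', η' <+: η → weight T μ S t (σ ++ η') < 1

/-- `G(σ, m)`: union of the cylinder sets `[ση]` over good `η` of length `m`. -/
def GSet {n : ℕ} (T : Matrix (Fin n) (Fin n) ℝ) (μ : Measure (ℤ → Fin n))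
    (S : Finset (List (Fin n))) (t : ℝ) (σ : List (Fin n)) (m : ℕ) :
    Set (ℤ → Fin n) :=
  ⋃ η ∈ {η : List (Fin n) | η.length = m ∧ GoodExt T μ S t σ η}, cylinder T (σ ++ η)

/-- The alphabet of `Σ_k`: admissible words of length `k` in `Σ`. -/
def BlockAlphabet {n : ℕ} (T : Matrix (Fin n) (Fin n) ℝ) (k : ℕ) :=
  {w : List (Fin n) // w.length = k ∧ Admissible T w}

/-- `Σ_k`: the SFT on admissible `k`-blocks, where `[x_1⋯x_k][y_1⋯y_k]` is an
allowed transition iff `x_k y_1` is admissible in `Σ`. -/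
def SigmaBlock {n : ℕ} [NeZero n] (T : Matrix (Fin n) (Fin n) ℝ) (k : ℕ) :
    Set (ℤ → BlockAlphabet T k) :=
  {y | ∀ i : ℤ, T ((y (i + 1)).val.head!) ((y i).val.getLast!) = 1}

/-- The natural block-concatenation map `Σ_k → Σ`. -/
def blockConcat {n : ℕ} [NeZero n] (T : Matrix (Fin n) (Fin n) ℝ) (k : ℕ)
    (y : ℤ → BlockAlphabet T k) : ℤ → Fin n :=
  fun m => (y (Int.fdiv m k)).val.getD (Int.fmod m k).toNat default


open Classical in
/-- The finite set of words of length `m` that are admissible and `S`-free. -/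
noncomputable def freeWords {n : ℕ} (T : Matrix (Fin n) (Fin n) ℝ)
    (S : Finset (List (Fin n))) (m : ℕ) : Finset (List (Fin n)) :=
  (List.finite_length_eq (Fin n) m).toFinset.filter fun w => Admissible T w ∧ SFree S w

/-- The weight of a word: `v a` if the word begins with `a`, and `c` if it is empty. -/
def headWeight {A : Type*} (v : A → ℝ) (c : ℝ) : List A → ℝ
  | [] => c
  | a :: _ => v a

/-- The total weight of the admissible `S`-free words of length `m`. -/
noncomputable def freeMass {n : ℕ} (T : Matrix (Fin n) (Fin n) ℝ)
    (S : Finset (List (Fin n))) (v : Fin n → ℝ) (c : ℝ) (m : ℕ) : ℝ :=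
  ∑ w ∈ freeWords T S m, headWeight v c w

section FreeWords

variable {n : ℕ} {T : Matrix (Fin n) (Fin n) ℝ} {S : Finset (List (Fin n))}

lemma mem_freeWords {m : ℕ} {w : List (Fin n)} :
    w ∈ freeWords T S m ↔ w.length = m ∧ Admissible T w ∧ SFree S w := by
  simp [freeWords]

lemma SFree.of_infix {A : Type*} {S : Finset (List A)} {u w : List A} (hw : SFree S w)
    (h : u <:+: w) : SFree S u :=
  fun τ hτ hu => hw τ hτ (hu.trans h)

lemma infix_mem_freeWords {m k : ℕ} {u w : List (Fin n)} (hw : w ∈ freeWords T S m)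
    (h : u <:+: w) (hu : u.length = k) : u ∈ freeWords T S k := by
  rw [mem_freeWords] at hw ⊢
  exact ⟨hu, List.IsChain.infix hw.2.1 h, hw.2.2.of_infix h⟩

lemma sum_cons_eq (hT01 : ∀ i j, T i j = 0 ∨ T i j = 1) {v : Fin n → ℝ} {lam : ℝ}
    (hv : T.mulVec v = lam • v) (b : Fin n) :
    ∑ a with T b a = 1, v a = lam * v b := by
  have h := congrFun hv b
  simp only [Matrix.mulVec, dotProduct, Pi.smul_apply, smul_eq_mul] at h
  rw [← h, Finset.sum_filter]
  refine Finset.sum_congr rfl fun a _ => ?_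
  rcases hT01 b a with h | h <;> simp [h]

open Classical in
/-- Passing to the admissible one-letter extensions on the left multiplies the total weight
by `lam`. -/
lemma lam_mul_freeMass_eq (hT01 : ∀ i j, T i j = 0 ∨ T i j = 1) {v : Fin n → ℝ} {lam : ℝ}
    (hv : T.mulVec v = lam • v) (c : ℝ) {m : ℕ} (hm : 1 ≤ m) :
    lam * freeMass T S v c m =
      ∑ p ∈ (Finset.univ ×ˢ freeWords T S m).filter
        (fun p : Fin n × List (Fin n) => Admissible T (p.1 :: p.2)), v p.1 := by
  rw [Finset.sum_filter, Finset.sum_product_right, freeMass, Finset.mul_sum]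
  refine Finset.sum_congr rfl fun w hw => ?_
  rw [mem_freeWords] at hw
  cases w with
  | nil => simp at hw; omega
  | cons b w =>
    rw [headWeight, ← sum_cons_eq hT01 hv b, Finset.sum_filter]
    refine Finset.sum_congr rfl fun a _ => ?_
    congr 1
    simp only [Admissible, eq_iff_iff]
    have := hw.2.1
    simp only [Admissible] at this
    exact ⟨fun h => List.isChain_cons_cons.2 ⟨h, this⟩, fun h => (List.isChain_cons_cons.1 h).1⟩

open Classical in
lemma freeMass_succ_eq (v : Fin n → ℝ) (c : ℝ) (m : ℕ) :
    freeMass T S v c (m + 1) =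
      ∑ p ∈ (Finset.univ ×ˢ freeWords T S m).filter
        (fun p : Fin n × List (Fin n) => Admissible T (p.1 :: p.2) ∧ SFree S (p.1 :: p.2)),
        v p.1 := by
  symm
  refine Finset.sum_bij (fun p _ => p.1 :: p.2) ?_ ?_ ?_ ?_
  · rintro ⟨a, w⟩ h
    simp only [Finset.mem_filter, Finset.mem_product, Finset.mem_univ, true_and,
      mem_freeWords] at h
    simp only [mem_freeWords, List.length_cons]
    exact ⟨by omega, h.2⟩
  · rintro ⟨a, w⟩ _ ⟨b, u⟩ _ h
    simpa using h
  · intro u hu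
    cases u with
    | nil => simp [mem_freeWords] at hu
    | cons a w =>
      have h := infix_mem_freeWords (k := m) hu (List.suffix_cons a w).isInfix
        (by simpa using (mem_freeWords.1 hu).1)
      exact ⟨(a, w), by simpa [h] using (mem_freeWords.1 hu).2, rfl⟩
  · rintro ⟨a, w⟩ _
    rfl

lemma lam_mul_freeMass_le (hT01 : ∀ i j, T i j = 0 ∨ T i j = 1) {v : Fin n → ℝ} {lam b : ℝ}
    (hv : T.mulVec v = lam • v) (hvb : ∀ i, v i ≤ b) (hv0 : ∀ i, 0 < v i)
    (hb : 0 ≤ b) (c : ℝ) {m : ℕ} (hm : 1 ≤ m) (hS : [] ∉ S) :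
    lam * freeMass T S v c m ≤ freeMass T S v c (m + 1) +
      ∑ τ ∈ S with τ.length ≤ m + 1, b * (freeWords T S (m + 1 - τ.length)).card := by
  classical
  rw [lam_mul_freeMass_eq hT01 hv c hm, freeMass_succ_eq, ← Finset.sum_filter_add_sum_filter_not
    ((Finset.univ ×ˢ freeWords T S m).filter
        (fun p : Fin n × List (Fin n) => Admissible T (p.1 :: p.2)))
    (fun p => SFree S (p.1 :: p.2)), Finset.filter_filter]
  gcongr
  set B := fun τ : List (Fin n) => ((Finset.univ ×ˢ freeWords T S m).filter
        (fun p : Fin n × List (Fin n) => Admissible T (p.1 :: p.2) ∧ τ <+: p.1 :: p.2))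
  have hB : ∀ τ ∈ S, (B τ).card ≤ (freeWords T S (m + 1 - τ.length)).card := by
    intro τ hτ
    refine Finset.card_le_card_of_injOn (fun p => (p.1 :: p.2).drop τ.length) ?_ ?_
    · rintro ⟨a, w⟩ h
      simp only [B, Finset.coe_filter, Finset.mem_product, Finset.mem_univ, true_and,
        Set.mem_ofPred_eq] at h
      obtain ⟨k, hk⟩ : ∃ k, τ.length = k + 1 :=
        Nat.exists_eq_succ_of_ne_zero fun h0 => hS (List.length_eq_zero_iff.1 h0 ▸ hτ)
      simp only [hk, List.drop_succ_cons, Finset.mem_coe]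
      exact infix_mem_freeWords h.1 (List.drop_suffix _ _).isInfix
        (by rw [List.length_drop, (mem_freeWords.1 h.1).1]; omega)
    · rintro ⟨a, w⟩ h ⟨a', w'⟩ h' heq
      simp only [B, Finset.coe_filter, Set.mem_ofPred_eq] at h h' heq
      have e := List.prefix_iff_eq_append.1 h.2.2
      have e' := List.prefix_iff_eq_append.1 h'.2.2
      rw [heq, e'] at e
      simpa using e.symm
  calc _ ≤ ∑ p ∈ (S.filter fun τ => τ.length ≤ m + 1).biUnion B, v p.1 := by
        refine Finset.sum_le_sum_of_subset_of_nonneg ?_ fun p _ _ => (hv0 _).le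
        rintro ⟨a, w⟩ h
        simp only [Finset.mem_filter, Finset.mem_product, Finset.mem_univ, true_and] at h
        obtain ⟨⟨hw, hadm⟩, hf⟩ := h
        simp only [SFree, not_forall, not_not] at hf
        obtain ⟨τ, hτ, hi⟩ := hf
        have hp : τ <+: a :: w := by
          rcases List.infix_cons_iff.1 hi with h | h
          · exact h
          · exact absurd h ((mem_freeWords.1 hw).2.2 τ hτ)
        have hl := hp.length_le
        rw [List.length_cons, (mem_freeWords.1 hw).1] at hl
        simp only [Finset.mem_biUnion, Finset.mem_filter]
        exact ⟨τ, ⟨hτ, hl⟩, by simp [B, hw, hadm, hp]⟩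
    _ ≤ b * ((S.filter fun τ => τ.length ≤ m + 1).biUnion B).card := by
        rw [mul_comm, ← nsmul_eq_mul]
        exact Finset.sum_le_card_nsmul _ _ _ fun p _ => hvb _
    _ ≤ b * ∑ τ ∈ S with τ.length ≤ m + 1, ((freeWords T S (m + 1 - τ.length)).card : ℝ) := by
        gcongr
        exact_mod_cast Finset.card_biUnion_le.trans
          (Finset.sum_le_sum fun τ hτ => hB τ (Finset.mem_filter.1 hτ).1)
    _ = _ := by rw [Finset.mul_sum]

end FreeWords

section Growth

variable {n : ℕ} {T : Matrix (Fin n) (Fin n) ℝ} {S : Finset (List (Fin n))} {v : Fin n → ℝ}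
  {b c : ℝ}

lemma le_headWeight (hcv : ∀ i, c ≤ v i) (w : List (Fin n)) : c ≤ headWeight v c w := by
  cases w with
  | nil => exact le_rfl
  | cons a w => exact hcv a

lemma headWeight_le (hcb : c ≤ b) (hvb : ∀ i, v i ≤ b) (w : List (Fin n)) :
    headWeight v c w ≤ b := by
  cases w with
  | nil => exact hcb
  | cons a w => exact hvb a

lemma card_mul_le_freeMass (hcv : ∀ i, c ≤ v i) (m : ℕ) :
    (freeWords T S m).card * c ≤ freeMass T S v c m := by
  rw [← nsmul_eq_mul]
  exact Finset.card_nsmul_le_sum _ _ _ fun w _ => le_headWeight hcv w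

lemma freeMass_le_card_mul (hcb : c ≤ b) (hvb : ∀ i, v i ≤ b) (m : ℕ) :
    freeMass T S v c m ≤ (freeWords T S m).card * b := by
  rw [← nsmul_eq_mul]
  exact Finset.sum_le_card_nsmul _ _ _ fun w _ => headWeight_le hcb hvb w

lemma freeWords_zero (hS : [] ∉ S) : freeWords T S 0 = {[]} := by
  ext w
  simp only [mem_freeWords, List.length_eq_zero_iff, Finset.mem_singleton]
  refine ⟨fun h => h.1, ?_⟩
  rintro rfl
  refine ⟨rfl, List.IsChain.nil, fun τ hτ h => ?_⟩
  rw [List.infix_nil] at h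
  exact hS (h ▸ hτ)

lemma freeMass_zero (hS : [] ∉ S) : freeMass T S v c 0 = c := by
  simp [freeMass, freeWords_zero hS, headWeight]

/-- The total weight of the `S`-free words grows at least by the factor `β` with each letter. -/
lemma mul_freeMass_le_succ [Nonempty (Fin n)] (hT01 : ∀ i j, T i j = 0 ∨ T i j = 1) {lam β : ℝ}
    (hv : T.mulVec v = lam • v) (hc : 0 < c) (hβ1 : 1 ≤ β) (hcv : ∀ i, β * c ≤ v i)
    (hvb : ∀ i, v i ≤ b) {N l : ℕ} (hSN : S.card ≤ N) (hl : 2 ≤ l)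
    (hSl : ∀ τ ∈ S, l ≤ τ.length) (hβ : β + b / c * N * (β ^ (l - 1))⁻¹ ≤ lam) (m : ℕ) :
    β * freeMass T S v c m ≤ freeMass T S v c (m + 1) := by
  have hβ0 : 0 < β := by linarith
  have hcv' : ∀ i, c ≤ v i := fun i => (le_mul_of_one_le_left hc.le hβ1).trans (hcv i)
  have hv0 : ∀ i, 0 < v i := fun i => hc.trans_le (hcv' i)
  have hb : 0 ≤ b := (hv0 (Classical.arbitrary _)).le.trans (hvb _)
  have hS : [] ∉ S := fun h => by have := hSl _ h; simp at this; omega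
  have hnn : ∀ w : List (Fin n), 0 ≤ headWeight v c w := fun w => hc.le.trans (le_headWeight hcv' w)
  induction m using Nat.strong_induction_on with
  | _ m ih =>
  rcases Nat.eq_zero_or_pos m with rfl | hm
  · rw [freeMass_zero hS]
    let i : Fin n := Classical.arbitrary _
    have hi : [i] ∈ freeWords T S (0 + 1) := by
      refine mem_freeWords.2 ⟨rfl, List.isChain_singleton _, fun τ hτ h => ?_⟩
      have := h.length_le
      have := hSl τ hτ
      simp at *
      omega
    exact (hcv i).trans (Finset.single_le_sum (f := headWeight v c) (fun w _ => hnn w) hi)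
  · have hpow : ∀ j ≤ m, β ^ j * freeMass T S v c (m - j) ≤ freeMass T S v c m := by
      intro j
      induction j with
      | zero => simp
      | succ j ihj =>
        intro hj
        refine le_trans ?_ (ihj (by omega))
        have := ih (m - (j + 1)) (by omega)
        rw [show m - (j + 1) + 1 = m - j by omega] at this
        rw [pow_succ, mul_assoc]
        gcongr
    have hA : 0 ≤ freeMass T S v c m := Finset.sum_nonneg fun w _ => hnn w
    have key : ∀ τ ∈ S.filter (fun τ => τ.length ≤ m + 1),
        b * (freeWords T S (m + 1 - τ.length)).card ≤
          b / c * (β ^ (l - 1))⁻¹ * freeMass T S v c m := by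
      intro τ hτ
      rw [Finset.mem_filter] at hτ
      have h1 := hSl τ hτ.1
      have h2 := hpow (τ.length - 1) (by omega)
      rw [show m - (τ.length - 1) = m + 1 - τ.length by omega] at h2
      have h3 : β ^ (l - 1) ≤ β ^ (τ.length - 1) := pow_le_pow_right₀ hβ1 (by omega)
      have h4 := card_mul_le_freeMass (T := T) (S := S) hcv' (m + 1 - τ.length)
      have h5 : β ^ (l - 1) * ((freeWords T S (m + 1 - τ.length)).card * c) ≤
          freeMass T S v c m := by
        refine le_trans ?_ h2
        gcongr
      calc b * ((freeWords T S (m + 1 - τ.length)).card : ℝ)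
          = b / c * (β ^ (l - 1))⁻¹ *
            (β ^ (l - 1) * ((freeWords T S (m + 1 - τ.length)).card * c)) := by
            field_simp
        _ ≤ _ := by gcongr
    have h := lam_mul_freeMass_le hT01 hv hvb hv0 hb c hm hS
    have hsum := Finset.sum_le_card_nsmul _ _ _ key
    have hcard : ((S.filter (fun τ => τ.length ≤ m + 1)).card : ℝ) ≤ N := by
      exact_mod_cast (Finset.card_filter_le _ _).trans hSN
    have hsum' : ∑ τ ∈ S with τ.length ≤ m + 1, b * (freeWords T S (m + 1 - τ.length)).card ≤
        N * (b / c * (β ^ (l - 1))⁻¹ * freeMass T S v c m) := by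
      refine hsum.trans ?_
      rw [nsmul_eq_mul]
      gcongr
    have := mul_le_mul_of_nonneg_right hβ hA
    linarith

lemma pow_mul_le_freeMass {β : ℝ} (hβ : 0 ≤ β) (hS : [] ∉ S)
    (h : ∀ m, β * freeMass T S v c m ≤ freeMass T S v c (m + 1)) (m : ℕ) :
    β ^ m * c ≤ freeMass T S v c m := by
  induction m with
  | zero => simp [freeMass_zero hS]
  | succ m ih =>
    refine le_trans ?_ (h m)
    rw [pow_succ', mul_assoc]
    gcongr

/-- An upper bound for the number of admissible words of a given length. -/
lemma card_freeWords_empty_le (hT01 : ∀ i j, T i j = 0 ∨ T i j = 1) {lam : ℝ} (hlam : 0 < lam)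
    (hv : T.mulVec v = lam • v) (hcv : ∀ i, c ≤ v i) (m : ℕ) :
    ((freeWords T ∅ (m + 1)).card : ℝ) * c ≤ freeMass T ∅ v c 1 / lam * lam ^ (m + 1) := by
  refine (card_mul_le_freeMass hcv _).trans (le_of_eq ?_)
  rw [pow_succ']
  induction m with
  | zero => field_simp
  | succ m ih =>
    have : freeMass T ∅ v c (m + 1 + 1) = lam * freeMass T ∅ v c (m + 1) := by
      classical
      rw [lam_mul_freeMass_eq hT01 hv c (by omega), freeMass_succ_eq]
      refine Finset.sum_congr (Finset.filter_congr fun p _ => ?_) fun _ _ => rfl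
      simp [SFree]
    rw [this, ih, pow_succ]
    field_simp

end Growth

section Compactness

variable {n : ℕ} {T : Matrix (Fin n) (Fin n) ℝ} {S : Finset (List (Fin n))}

/-- By compactness, the central subword of a sufficiently long admissible `S`-free word occurs
in an element of `Σ⟨S⟩`. -/
lemma exists_radius (T : Matrix (Fin n) (Fin n) ℝ) (S : Finset (List (Fin n))) (k : ℕ) :
    ∃ r : ℕ, ∀ p u s : List (Fin n), p.length = r → u.length = k → s.length = r →
      Admissible T (p ++ u ++ s) → SFree S (p ++ u ++ s) →
      ∃ x ∈ Avoid T S, Occurs u x := by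
  by_contra! hcon
  choose p u s hp hu hs hadm hfree hno using hcon
  let U : Ultrafilter ℕ := Filter.hyperfilter ℕ
  set w : ℕ → List (Fin n) := fun r => p r ++ u r ++ s r with hw
  have hU : (U : Filter ℕ) ≤ atTop := Nat.hyperfilter_le_atTop
  have hlim : ∀ i : ℤ, ∃ a, ∀ᶠ r : ℕ in (U : Filter ℕ),
      0 ≤ i + r ∧ (w r)[(i + r).toNat]? = some a := by
    intro i
    rw [← Ultrafilter.eventually_exists_iff]
    refine hU ?_
    filter_upwards [eventually_ge_atTop (i.natAbs + 1)] with r hr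
    have hlt : (i + r).toNat < (w r).length := by
      simp only [hw, List.length_append, hp, hu, hs]
      omega
    exact ⟨_, by omega, List.getElem?_eq_getElem hlt⟩
  choose x hx using hlim
  have hx' : ∀ (a : ℤ) (m : ℕ), ∃ r : ℕ, ∀ j < m,
      0 ≤ a + j + r ∧ (w r)[(a + j + r).toNat]? = some (x (a + j)) := by
    intro a m
    have : ∀ᶠ r : ℕ in (U : Filter ℕ), ∀ j ∈ Finset.range m,
      0 ≤ a + j + r ∧ (w r)[(a + j + r).toNat]? = some (x (a + j)) :=
      (Filter.eventually_all_finset _).2 fun j _ => hx (a + j)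
    obtain ⟨r, hr⟩ := this.exists
    exact ⟨r, fun j hj => hr j (Finset.mem_range.2 hj)⟩
  have hmem : x ∈ Avoid T S := by
    refine ⟨fun i => ?_, ?_⟩
    · obtain ⟨r, hr⟩ := hx' i 2
      obtain ⟨h0, h1⟩ := hr 0 (by omega)
      obtain ⟨h2, h3⟩ := hr 1 (by omega)
      simp only [Nat.cast_zero, add_zero, Nat.cast_one] at h0 h1 h2 h3
      rw [show (i + 1 + r).toNat = (i + r).toNat + 1 by omega] at h3
      obtain ⟨h1l, h1e⟩ := List.getElem?_eq_some_iff.1 h1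
      obtain ⟨h3l, h3e⟩ := List.getElem?_eq_some_iff.1 h3
      rw [← h1e, ← h3e]
      exact List.isChain_iff_getElem.1 (hadm r) _ h3l
    · rintro τ hτ ⟨a, ha⟩
      obtain ⟨r, hr⟩ := hx' a τ.length
      refine hfree r τ hτ ?_
      by_cases h0 : τ.length = 0
      · rw [List.length_eq_zero_iff.1 h0]
        exact List.nil_infix
      have ha0 : 0 ≤ a + r := by simpa using (hr 0 (by omega)).1
      refine List.infix_iff_getElem?.2 ⟨(a + r).toNat, ?_, fun j hj => ?_⟩
      · obtain ⟨h1, h2⟩ := hr (τ.length - 1) (by omega)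
        obtain ⟨h3, -⟩ := List.getElem?_eq_some_iff.1 h2
        change _ ≤ (w r).length
        omega
      · change (w r)[_]? = _
        have := (hr j hj).2
        rw [show (a + j + r).toNat = j + (a + r).toNat by omega, ha j hj] at this
        exact this
  obtain ⟨r, hr⟩ := hx' 0 k
  refine hno r x hmem ⟨0, fun j hj => ?_⟩
  have := (hr j (hu r ▸ hj)).2
  rw [show ((0 : ℤ) + j + r).toNat = (p r).length + j by rw [hp]; omega] at this
  simp only [hw, List.append_assoc] at this
  rw [List.getElem?_append_right (by omega), Nat.add_sub_cancel_left,
    List.getElem?_append_left hj, List.getElem?_eq_getElem hj] at this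
  exact (Option.some.inj this).symm

open Classical in
/-- The concatenations of `j` words from `H`. -/
noncomputable def blockWords {A : Type*} (H : Finset (List A)) : ℕ → Finset (List A)
  | 0 => {[]}
  | j + 1 => (H ×ˢ blockWords H j).image fun q => q.1 ++ q.2

lemma card_blockWords_le {A : Type*} (H : Finset (List A)) (j : ℕ) :
    (blockWords H j).card ≤ H.card ^ j := by
  classical
  induction j with
  | zero => simp [blockWords]
  | succ j ih =>
    rw [blockWords, pow_succ']
    refine Finset.card_image_le.trans ?_
    rw [Finset.card_product]
    gcongr

lemma mem_blockWords {A : Type*} {H : Finset (List A)} {k : ℕ} (j : ℕ) (w : List A)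
    (hw : w.length = j * k) (h : ∀ u, u <:+: w → u.length = k → u ∈ H) :
    w ∈ blockWords H j := by
  classical
  induction j generalizing w with
  | zero => simpa [blockWords] using hw
  | succ j ih =>
    rw [blockWords, Finset.mem_image]
    have hk : (j + 1) * k = j * k + k := by ring
    refine ⟨(w.take k, w.drop k), Finset.mem_product.2 ⟨?_, ?_⟩, List.take_append_drop k w⟩
    · exact h _ (List.take_prefix _ _).isInfix (by rw [List.length_take]; omega)
    · refine ih _ (by rw [List.length_drop]; omega) fun u hu hk => h u ?_ hk
      exact hu.trans (List.drop_suffix _ _).isInfix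

/-- The growth rate of the admissible `S`-free words is attained by the words occurring in
`Σ⟨S⟩`. -/
lemma exists_card_freeWords_le (T : Matrix (Fin n) (Fin n) ℝ) (S : Finset (List (Fin n)))
    (k : ℕ) : ∃ r : ℕ, ∃ D : ℝ, ∀ j : ℕ,
      ((freeWords T S (r + j * k + r)).card : ℝ) ≤ D * (wordCount (Avoid T S) k : ℝ) ^ j := by
  classical
  obtain ⟨r, hr⟩ := exists_radius T S k
  have hfin : {w : List (Fin n) | w.length = k ∧ ∃ x ∈ Avoid T S, Occurs w x}.Finite :=
    (List.finite_length_eq (Fin n) k).subset fun w hw => hw.1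
  set H := hfin.toFinset with hH
  have hHcard : H.card = wordCount (Avoid T S) k := (Set.ncard_eq_toFinset_card _ hfin).symm
  set E := (List.finite_length_eq (Fin n) r).toFinset with hE
  refine ⟨r, (E.card : ℝ) * E.card, fun j => ?_⟩
  have hsub : freeWords T S (r + j * k + r) ⊆
      ((E ×ˢ E) ×ˢ blockWords H j).image fun q => q.1.1 ++ q.2 ++ q.1.2 := by
    intro w hw
    have hlen := (mem_freeWords.1 hw).1
    obtain ⟨p, u, s, rfl, hp, hu, hs⟩ : ∃ p u s, w = p ++ u ++ s ∧
        p.length = r ∧ u.length = j * k ∧ s.length = r := by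
      refine ⟨w.take r, (w.drop r).take (j * k), (w.drop r).drop (j * k), ?_, ?_, ?_, ?_⟩
      · simp
      all_goals simp; omega
    refine Finset.mem_image.2 ⟨((p, s), u), ?_, rfl⟩
    simp only [Finset.mem_product, hE, Set.Finite.mem_toFinset]
    refine ⟨⟨hp, hs⟩, mem_blockWords j u hu fun b hb hbk => ?_⟩
    rw [hH, Set.Finite.mem_toFinset]
    refine ⟨hbk, ?_⟩
    obtain ⟨u₁, u₂, rfl⟩ := hb
    have hmid := infix_mem_freeWords (u := (p ++ u₁).drop u₁.length ++ b ++ (u₂ ++ s).take r)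
      (k := r + k + r) hw
      ⟨(p ++ u₁).take u₁.length, (u₂ ++ s).drop r, by
        simp only [← List.append_assoc, List.take_append_drop]
        simp only [List.append_assoc, List.take_append_drop]⟩
      (by simp; omega)
    exact hr _ b _ (by simp; omega) hbk (by simp; omega) (mem_freeWords.1 hmid).2.1
      (mem_freeWords.1 hmid).2.2
  have hcard : (freeWords T S (r + j * k + r)).card ≤ E.card * E.card * H.card ^ j := by
    refine (Finset.card_le_card hsub).trans (Finset.card_image_le.trans ?_)
    rw [Finset.card_product, Finset.card_product]
    gcongr
    exact card_blockWords_le H j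
  rw [← hHcard]
  exact_mod_cast hcard

end Compactness

section Entropy

variable {n : ℕ} {T : Matrix (Fin n) (Fin n) ℝ}

lemma le_of_forall_mul_pow_le {c D x y : ℝ} (hc : 0 < c) (hx : 0 < x) (hy : 0 ≤ y)
    (h : ∀ j : ℕ, c * x ^ j ≤ D * y ^ j) : x ≤ y := by
  by_contra! hyx
  have hlim : Tendsto (fun j : ℕ => D * (y / x) ^ j) atTop (nhds (D * 0)) :=
    (tendsto_pow_atTop_nhds_zero_of_lt_one (by positivity) ((div_lt_one hx).2 hyx)).const_mul D
  have : c ≤ D * 0 := ge_of_tendsto' hlim fun j => by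
    rw [div_pow, ← mul_div_assoc, le_div_iff₀ (by positivity)]
    exact h j
  linarith

lemma wordCount_mono {A : Type*} [Finite A] {X Y : Set (ℤ → A)} (h : X ⊆ Y) (m : ℕ) :
    wordCount X m ≤ wordCount Y m :=
  Set.ncard_le_ncard (fun _ ⟨hw, x, hx, ho⟩ => ⟨hw, x, h hx, ho⟩)
    ((List.finite_length_eq A m).subset fun _ hw => hw.1)

lemma admissible_of_occurs {w : List (Fin n)} {x : ℤ → Fin n} (hx : x ∈ SFTspace T)
    (h : Occurs w x) : Admissible T w := by
  obtain ⟨a, ha⟩ := h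
  refine List.isChain_iff_getElem.2 fun i hi => ?_
  have h0 := ha i (by omega)
  have h1 := ha (i + 1) hi
  have h2 := hx (a + i)
  simp only [List.get_eq_getElem, Nat.cast_add, Nat.cast_one, ← add_assoc] at h0 h1
  rwa [h0, h1] at h2

lemma wordCount_SFTspace_le (T : Matrix (Fin n) (Fin n) ℝ) (m : ℕ) :
    wordCount (SFTspace T) m ≤ (freeWords T ∅ m).card := by
  rw [← Set.ncard_coe_finset]
  refine Set.ncard_le_ncard (fun w ⟨hw, x, hx, ho⟩ => ?_) (Finset.finite_toSet _)
  exact mem_freeWords.2 ⟨hw, admissible_of_occurs hx ho, by simp [SFree]⟩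

lemma log_wordCount_div_nonneg {A : Type*} (X : Set (ℤ → A)) (m : ℕ) :
    0 ≤ Real.log (wordCount X m) / m :=
  div_nonneg (Real.log_natCast_nonneg _) (Nat.cast_nonneg _)

/-- If the word counts are eventually at most `K * lam ^ m`, then so are the normalised
logarithms, up to a term tending to `0`. -/
lemma log_wordCount_div_le {A : Type*} {X : Set (ℤ → A)} {K lam : ℝ} (hK : 1 ≤ K)
    (hlam : 1 ≤ lam) {m : ℕ} (hm : 1 ≤ m) (h : (wordCount X m : ℝ) ≤ K * lam ^ m) :
    Real.log (wordCount X m) / m ≤ Real.log K / m + Real.log lam := by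
  have hm' : (0 : ℝ) < m := by exact_mod_cast hm
  rw [div_le_iff₀ hm', add_mul, div_mul_cancel₀ _ hm'.ne']
  rcases Nat.eq_zero_or_pos (wordCount X m) with h0 | h0
  · have := Real.log_nonneg hK
    have := Real.log_nonneg hlam
    rw [h0]
    simp only [Nat.cast_zero, Real.log_zero]
    positivity
  · refine (Real.log_le_log (by exact_mod_cast h0) h).trans (le_of_eq ?_)
    rw [Real.log_mul (by positivity) (by positivity), Real.log_pow, mul_comm (m : ℝ)]

lemma entropy_le {A : Type*} {X : Set (ℤ → A)} {K lam : ℝ} (hK : 1 ≤ K)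
    (hlam : 1 ≤ lam) (h : ∀ m, 1 ≤ m → (wordCount X m : ℝ) ≤ K * lam ^ m) :
    entropy X ≤ Real.log lam := by
  have hlim : Tendsto (fun m : ℕ => Real.log K / m + Real.log lam) atTop
      (nhds (Real.log lam)) := by
    simpa using (tendsto_const_div_atTop_nhds_zero_nat (Real.log K)).add_const (Real.log lam)
  rw [← hlim.limsup_eq]
  refine limsup_le_limsup ?_ ?_ hlim.isBoundedUnder_le
  · filter_upwards [eventually_ge_atTop 1] with m hm
    exact log_wordCount_div_le hK hlam hm (h m hm)
  · exact (isBoundedUnder_of ⟨0, log_wordCount_div_nonneg X⟩ :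
      IsBoundedUnder (· ≥ ·) atTop _).isCoboundedUnder_le

lemma le_entropy {A : Type*} {X : Set (ℤ → A)} {K lam β : ℝ} (hK : 1 ≤ K)
    (hlam : 1 ≤ lam) (h : ∀ m, 1 ≤ m → (wordCount X m : ℝ) ≤ K * lam ^ m) (hβ : 0 < β)
    (hX : ∀ m, β ^ m ≤ (wordCount X m : ℝ)) :
    Real.log β ≤ entropy X := by
  refine le_limsup_of_frequently_le (Eventually.frequently ?_) ?_
  · filter_upwards [eventually_ge_atTop 1] with m hm
    have hm' : (0 : ℝ) < m := by exact_mod_cast hm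
    rw [le_div_iff₀ hm', mul_comm, ← Real.log_pow]
    exact Real.log_le_log (by positivity) (hX m)
  · refine IsBoundedUnder.mono_le (u := fun m : ℕ => Real.log K / m + Real.log lam) ?_ ?_
    · exact ((tendsto_const_div_atTop_nhds_zero_nat (Real.log K)).add_const
        (Real.log lam)).isBoundedUnder_le
    · filter_upwards [eventually_ge_atTop 1] with m hm
      exact log_wordCount_div_le hK hlam hm (h m hm)

/-- There is a constant `K` such that, whenever `β + K N β^{1-l} ≤ lam`, forbidding at most `N`
words of length at least `l` decreases the entropy by at most `log lam - log β`. -/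
lemma exists_entropy_sub_le [Nonempty (Fin n)] (hT01 : ∀ i j, T i j = 0 ∨ T i j = 1) {lam : ℝ}
    (hlam : 1 < lam) {v : Fin n → ℝ} (hv0 : ∀ i, 0 < v i) (hv : T.mulVec v = lam • v) :
    ∃ K : ℝ, 0 < K ∧ ∀ (S : Finset (List (Fin n))) (N l : ℕ) (β : ℝ), S.card ≤ N → 2 ≤ l →
      (∀ τ ∈ S, l ≤ τ.length) → 1 ≤ β → β ≤ lam → β + K * N * (β ^ (l - 1))⁻¹ ≤ lam →
      entropy (SFTspace T) - entropy (Avoid T S) ≤ Real.log lam - Real.log β := by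
  obtain ⟨i₀, hi₀⟩ := Finite.exists_min v
  obtain ⟨i₁, hi₁⟩ := Finite.exists_max v
  have hlam0 : 0 < lam := by linarith
  set c := v i₀ / lam with hc_def
  have hc : 0 < c := div_pos (hv0 i₀) hlam0
  have hlc : lam * c = v i₀ := by rw [hc_def]; field_simp
  have hcv : ∀ i, c ≤ v i := fun i =>
    (le_mul_of_one_le_left hc.le hlam.le).trans (hlc.le.trans (hi₀ i))
  refine ⟨v i₁ / c, div_pos (hv0 i₁) hc, fun S N l β hSN hl hSl hβ1 hβlam hβ => ?_⟩
  have hS : [] ∉ S := fun h => by have := hSl _ h; simp at this; omega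
  have hβ0 : 0 < β := by linarith
  have hgrow := mul_freeMass_le_succ hT01 hv hc hβ1
    (fun i => (mul_le_mul_of_nonneg_right hβlam hc.le).trans (hlc.le.trans (hi₀ i)))
    hi₁ hSN hl hSl hβ
  set K := max 1 (freeMass T ∅ v c 1 / lam / c)
  have hupper : ∀ m, 1 ≤ m → (wordCount (SFTspace T) m : ℝ) ≤ K * lam ^ m := by
    intro m hm
    obtain ⟨m, rfl⟩ := Nat.exists_eq_add_of_le' hm
    have h1 : (wordCount (SFTspace T) (m + 1) : ℝ) ≤ (freeWords T ∅ (m + 1)).card := by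
      exact_mod_cast wordCount_SFTspace_le T (m + 1)
    have h2 := card_freeWords_empty_le hT01 hlam0 hv hcv m
    rw [← le_div_iff₀ hc, mul_div_right_comm] at h2
    refine (h1.trans h2).trans ?_
    gcongr
    exact le_max_right _ _
  have hupper' : ∀ m, 1 ≤ m → (wordCount (Avoid T S) m : ℝ) ≤ K * lam ^ m := fun m hm =>
    le_trans (by exact_mod_cast wordCount_mono (Set.sep_subset _ _) m) (hupper m hm)
  have hlower : ∀ k, β ^ k ≤ (wordCount (Avoid T S) k : ℝ) := by
    intro k
    obtain ⟨r, D, hD⟩ := exists_card_freeWords_le T S k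
    have hb := hv0 i₁
    refine le_of_forall_mul_pow_le (c := c / v i₁) (D := D) (div_pos hc hb) (by positivity)
      (Nat.cast_nonneg _) fun j => ?_
    refine le_trans ?_ (hD j)
    rw [div_mul_eq_mul_div, div_le_iff₀ hb]
    refine le_trans ?_ (freeMass_le_card_mul (c := c) (hcv i₁) hi₁ _)
    refine le_trans ?_ (pow_mul_le_freeMass hβ0.le hS hgrow _)
    rw [mul_comm, ← pow_mul]
    gcongr
    rw [mul_comm]; omega
  have h1 := entropy_le (le_max_left _ _) hlam.le hupper
  have h2 := le_entropy (le_max_left _ _) hlam.le hupper' hβ0 hlower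
  linarith

end Entropy

section Asymptotics

/-- The decay estimates needed for the choice `β = lam * exp (-ε)` with
`ε = l ^ (-3/4) * lam ^ (-l/8)`. -/
lemma eventually_error_bounds {lam : ℝ} (hlam : 1 < lam) {M δ : ℝ} (hM : 0 ≤ M) (hδ : 0 < δ) :
    ∀ᶠ l : ℕ in atTop,
      l * ((l : ℝ) ^ (-(3 : ℝ) / 4) * lam ^ (-(l : ℝ) / 8)) ≤ δ ∧
      M * (lam ^ l)⁻¹ ≤ (l : ℝ) ^ (-(3 : ℝ) / 4) * lam ^ (-(l : ℝ) / 8) := by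
  have hlam0 : 0 < lam := by linarith
  have hlog : 0 < Real.log lam := Real.log_pos hlam
  have h1 := (tendsto_rpow_mul_exp_neg_mul_atTop_nhds_zero (1 / 4) (Real.log lam / 8)
    (by positivity)).comp tendsto_natCast_atTop_atTop
  have h2 := (tendsto_rpow_mul_exp_neg_mul_atTop_nhds_zero (3 / 4) (7 * Real.log lam / 8)
    (by positivity)).comp tendsto_natCast_atTop_atTop
  filter_upwards [h1.eventually_le_const hδ,
    h2.eventually_le_const (show (0 : ℝ) < 1 / (M + 1) by positivity),
    eventually_ge_atTop 1] with l hl1 hl2 hl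
  have hl0 : (0 : ℝ) < l := by exact_mod_cast hl
  simp only [Function.comp_apply] at hl1 hl2
  constructor
  · refine le_trans (le_of_eq ?_) hl1
    rw [← mul_assoc, Real.rpow_def_of_pos hlam0]
    congr 1
    · nth_rewrite 1 [← Real.rpow_one (l : ℝ)]
      rw [← Real.rpow_add hl0]
      norm_num
    · congr 1; ring
  · rw [le_div_iff₀ (by positivity)] at hl2
    have e1 : (lam ^ l)⁻¹ = (l : ℝ) ^ ((3 : ℝ) / 4) * Real.exp (-(7 * Real.log lam / 8) * l) *
        ((l : ℝ) ^ (-(3 : ℝ) / 4) * lam ^ (-(l : ℝ) / 8)) := by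
      have e2 : (l : ℝ) ^ ((3 : ℝ) / 4) * (l : ℝ) ^ (-(3 : ℝ) / 4) = 1 := by
        rw [← Real.rpow_add hl0]; norm_num
      have e3 : Real.exp (-(7 * Real.log lam / 8) * l) * lam ^ (-(l : ℝ) / 8) =
          (lam ^ l)⁻¹ := by
        rw [Real.rpow_def_of_pos hlam0, ← Real.exp_add, ← Real.rpow_natCast,
          ← Real.rpow_neg hlam0.le, Real.rpow_def_of_pos hlam0]
        congr 1; ring
      calc (lam ^ l)⁻¹ = ((l : ℝ) ^ ((3 : ℝ) / 4) * (l : ℝ) ^ (-(3 : ℝ) / 4)) *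
            (Real.exp (-(7 * Real.log lam / 8) * l) * lam ^ (-(l : ℝ) / 8)) := by
            rw [e2, e3, one_mul]
        _ = _ := by ring
    rw [e1, ← mul_assoc]
    have hε : 0 ≤ (l : ℝ) ^ (-(3 : ℝ) / 4) * lam ^ (-(l : ℝ) / 8) := by positivity
    refine mul_le_of_le_one_left hε ?_
    have : 0 ≤ (l : ℝ) ^ ((3 : ℝ) / 4) * Real.exp (-(7 * Real.log lam / 8) * l) := by positivity
    nlinarith

lemma half_le_one_sub_exp_neg {x : ℝ} (h0 : 0 ≤ x) (h1 : x ≤ 1) :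
    x / 2 ≤ 1 - Real.exp (-x) := by
  have h2 := Real.add_one_le_exp x
  have h3 : Real.exp (-x) ≤ (1 + x)⁻¹ := by
    rw [Real.exp_neg]
    exact inv_anti₀ (by positivity) (by linarith)
  have h4 : (1 + x)⁻¹ ≤ 1 - x / 2 := by
    rw [inv_le_iff_one_le_mul₀ (by positivity)]
    nlinarith
  linarith

lemma add_mul_inv_pow_le {lam ε K : ℝ} (hlam : 1 < lam) (hK : 0 ≤ K) (hε : 0 ≤ ε) {l : ℕ}
    (hl : 1 ≤ l) (hlε : l * ε ≤ 1) (h : 2 * K * Real.exp 1 * (lam ^ l)⁻¹ ≤ ε) :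
    lam * Real.exp (-ε) + K * ((lam * Real.exp (-ε)) ^ (l - 1))⁻¹ ≤ lam := by
  have hlam0 : 0 < lam := by linarith
  obtain ⟨l, rfl⟩ := Nat.exists_eq_add_of_le' hl
  have hl0 : (0 : ℝ) ≤ l := Nat.cast_nonneg l
  push_cast at hlε
  have hε1 : ε ≤ 1 := by nlinarith
  have h1 := half_le_one_sub_exp_neg hε hε1
  have h2 : ((lam * Real.exp (-ε)) ^ l)⁻¹ ≤ lam * (Real.exp 1 * (lam ^ (l + 1))⁻¹) := by
    rw [mul_pow, mul_inv, ← Real.exp_nat_mul, ← Real.exp_neg, pow_succ]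
    have : Real.exp (-(l * -ε)) ≤ Real.exp 1 := Real.exp_le_exp.2 (by nlinarith)
    calc (lam ^ l)⁻¹ * Real.exp (-(l * -ε)) ≤ (lam ^ l)⁻¹ * Real.exp 1 := by gcongr
      _ = _ := by field_simp
  rw [Nat.add_sub_cancel]
  have h3 := mul_le_mul_of_nonneg_left h2 hK
  nlinarith

end Asymptotics

/-- **Fixed number of words.** For a fixed positive integer `N` there are `C' > 0`
and a threshold `L` (depending only on `Σ` and `N`) such that for every set `S` of
at most `N` admissible words, pairwise not containing one another, all of length at
least `ℓ ≥ L`, one has `h(Σ) - h(Σ⟨S⟩) ≤ C'·ℓ^{-3/4}·λ^{-ℓ/8}`. -/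
theorem entropy_bound_fixed_card
    {n : ℕ} (T : Matrix (Fin n) (Fin n) ℝ) (lam : ℝ)
    (hT01 : ∀ i j, T i j = 0 ∨ T i j = 1)
    (hirr : ∀ i j : Fin n, ∃ m : ℕ, 0 < m ∧ 0 < (T ^ m) i j)
    (hlam : 1 < lam)
    (hPerron : ∃ v : Fin n → ℝ, (∀ i, 0 < v i) ∧ T.mulVec v = lam • v)
    (N : ℕ) (hN : 1 ≤ N) :
    ∃ C' : ℝ, 0 < C' ∧ ∃ L : ℕ,
      ∀ S : Finset (List (Fin n)),
        S.card ≤ N →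
        (∀ τ ∈ S, τ ≠ []) → (∀ τ ∈ S, Admissible T τ) →
        (∀ τ ∈ S, ∀ τ' ∈ S, τ ≠ τ' → ¬ τ <:+: τ') →
        ∀ l : ℕ, L ≤ l → (∀ τ ∈ S, l ≤ τ.length) →
        entropy (SFTspace T) - entropy (Avoid T S) ≤
          C' * (l : ℝ) ^ (-(3 : ℝ) / 4) * lam ^ (-(l : ℝ) / 8) := by
  obtain ⟨v, hv0, hv⟩ := hPerron
  refine ⟨1, one_pos, ?_⟩
  rcases isEmpty_or_nonempty (Fin n) with hn | hn
  · refine ⟨0, fun S _ _ _ _ l _ _ => ?_⟩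
    have hX : ∀ X : Set (ℤ → Fin n), entropy X = 0 := fun X => by
      have hcount : ∀ m, wordCount X m = 0 := fun m => by
        have : {w : List (Fin n) | w.length = m ∧ ∃ x ∈ X, Occurs w x} = ∅ :=
          Set.eq_empty_of_forall_notMem fun _ ⟨_, x, _⟩ => isEmptyElim (x 0)
        rw [wordCount, this, Set.ncard_empty]
      simp [entropy, hcount]
    rw [hX, hX, sub_zero]
    positivity
  obtain ⟨K, hK, hbound⟩ := exists_entropy_sub_le hT01 hlam hv0 hv
  have hlog : 0 < Real.log lam := Real.log_pos hlam
  have hlam0 : 0 < lam := by linarith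
  obtain ⟨L, hL⟩ := eventually_atTop.1 (eventually_error_bounds hlam
    (M := 2 * (K * N) * Real.exp 1) (by positivity) (lt_min one_pos hlog))
  refine ⟨max L 2, fun S hSN _ _ _ l hLl hSl => ?_⟩
  obtain ⟨h1, h2⟩ := hL l ((le_max_left _ _).trans hLl)
  have hl2 : 2 ≤ l := (le_max_right _ _).trans hLl
  rw [one_mul]
  set ε := (l : ℝ) ^ (-(3 : ℝ) / 4) * lam ^ (-(l : ℝ) / 8)
  have hε : 0 ≤ ε := by positivity
  have hεl : ε ≤ l * ε := le_mul_of_one_le_left hε (by exact_mod_cast (by omega : 1 ≤ l))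
  have hβ : lam * Real.exp (-ε) = Real.exp (Real.log lam - ε) := by
    rw [sub_eq_add_neg, Real.exp_add, Real.exp_log hlam0]
  refine (hbound S N l (lam * Real.exp (-ε)) hSN hl2 hSl ?_ ?_ ?_).trans (le_of_eq ?_)
  · rw [hβ, Real.one_le_exp_iff]
    linarith [h1.trans (min_le_right _ _)]
  · exact mul_le_of_le_one_right hlam0.le (Real.exp_le_one_iff.2 (by linarith))
  · exact add_mul_inv_pow_le hlam (by positivity) hε (by omega) (h1.trans (min_le_left _ _)) h2
  · rw [hβ, Real.log_exp]
    ring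

end SFT
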